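/- arXiv:0911.0601 — 3 statements merged into one kernel-verified Lean document; each statement's English description precedes it below -/
import Mathlib

section
/- For all integers n ≥ 4 and i with 1 ≤ i ≤ n-3, one has ∏_{k=0}^{i-1} (n+3-k)/(2n-1-k) ≤ e^{7/2} · 2^{-i}. In particular, there is a constant C (independent of n and i) such that the hitting probability q_{n+3,n-3}(i,1) = (i+1) · ((n-3)/(2n)) · ∏_{k=0}^{i-1} (n+3-k)/(2n-1-k) satisfies q_{n+3,n-3}(i,1) ≤ C · (i+1) · 2^{-i}. -/
theorem ratio_bound_aux (n i : ℕ) (hn : 4 ≤ n) (hi : i ≤ n - 3) :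
    ∏ k ∈ Finset.range i, ((n : ℝ) + 3 - (k : ℝ)) / (2 * (n : ℝ) - 1 - (k : ℝ))
        ≤ Real.exp (7 / 2) * (2 : ℝ) ^ (-(i : ℤ)) := by
  have hn' : (4 : ℝ) ≤ n := by exact_mod_cast hn
  have hi' : (i : ℝ) + 3 ≤ n := by
    have : i + 3 ≤ n := by omega
    exact_mod_cast this
  have hd : (0 : ℝ) < 2 * n - 1 := by linarith
  have h1 : ∏ k ∈ Finset.range i, ((n : ℝ) + 3 - (k : ℝ)) / (2 * (n : ℝ) - 1 - (k : ℝ))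
      ≤ ∏ _k ∈ Finset.range i, (Real.exp (7 / (2 * (n : ℝ) - 1)) * (1 / 2)) := by
    apply Finset.prod_le_prod
    · intro k hk
      have hk' : (k : ℝ) < i := by exact_mod_cast Finset.mem_range.mp hk
      apply div_nonneg <;> linarith
    · intro k hk
      have hk' : (k : ℝ) < i := by exact_mod_cast Finset.mem_range.mp hk
      have hk0 : (0 : ℝ) ≤ k := Nat.cast_nonneg k
      have hdk : (0 : ℝ) < 2 * n - 1 - k := by linarith
      have he := Real.add_one_le_exp (7 / (2 * (n : ℝ) - 1))
      have : ((n : ℝ) + 3 - k) / (2 * n - 1 - k) ≤ (7 / (2 * (n : ℝ) - 1) + 1) * (1 / 2) := by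
        have e : (7 / (2 * (n : ℝ) - 1) + 1) * (1 / 2) = (2 * n + 6) / (2 * (2 * n - 1)) := by
          field_simp
          ring
        rw [e, div_le_div_iff₀ hdk (by linarith)]
        nlinarith [mul_nonneg hk0 (by linarith : (0 : ℝ) ≤ n - 4)]
      linarith
  refine h1.trans ?_
  rw [Finset.prod_const, Finset.card_range, mul_pow, ← Real.exp_nat_mul, zpow_neg, zpow_natCast,
    one_div, inv_pow]
  gcongr
  rw [← mul_div_assoc, div_le_div_iff₀ hd (by norm_num)]
  linarith

/-- For all integers `n ≥ 4` and `1 ≤ i ≤ n-3` one has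
`∏_{k=0}^{i-1} (n+3-k)/(2n-1-k) ≤ e^{7/2} · 2^{-i}`; in particular there is a
constant `C`, independent of `n` and `i`, such that the hitting probability
`q_{n+3,n-3}(i,1) = (i+1) · ((n-3)/(2n)) · ∏_{k=0}^{i-1} (n+3-k)/(2n-1-k)`
satisfies `q_{n+3,n-3}(i,1) ≤ C · (i+1) · 2^{-i}`. -/
theorem falling_factorial_ratio_geometric_bound :
    (∀ n i : ℕ, 4 ≤ n → 1 ≤ i → i ≤ n - 3 →
      ∏ k ∈ Finset.range i, ((n : ℝ) + 3 - (k : ℝ)) / (2 * (n : ℝ) - 1 - (k : ℝ))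
        ≤ Real.exp (7 / 2) * (2 : ℝ) ^ (-(i : ℤ)))
    ∧ ∃ C : ℝ, ∀ n i : ℕ, 4 ≤ n → 1 ≤ i → i ≤ n - 3 →
      ((i : ℝ) + 1) * (((n : ℝ) - 3) / (2 * (n : ℝ)))
          * ∏ k ∈ Finset.range i, ((n : ℝ) + 3 - (k : ℝ)) / (2 * (n : ℝ) - 1 - (k : ℝ))
        ≤ C * ((i : ℝ) + 1) * (2 : ℝ) ^ (-(i : ℤ)) := by
  refine ⟨fun n i hn _ hi => ratio_bound_aux n i hn hi, Real.exp (7 / 2), ?_⟩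
  intro n i hn _ hi
  have hn' : (4 : ℝ) ≤ n := by exact_mod_cast hn
  have h := ratio_bound_aux n i hn hi
  have hc0 : (0 : ℝ) ≤ ((n : ℝ) - 3) / (2 * (n : ℝ)) := by
    apply div_nonneg <;> linarith
  have hc : ((n : ℝ) - 3) / (2 * (n : ℝ)) ≤ 1 := by
    rw [div_le_one (by linarith)]
    linarith
  have hi0 : (0 : ℝ) ≤ (i : ℝ) + 1 := by positivity
  calc _ ≤ ((i : ℝ) + 1) * (((n : ℝ) - 3) / (2 * (n : ℝ)))
        * (Real.exp (7 / 2) * (2 : ℝ) ^ (-(i : ℤ))) :=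
        mul_le_mul_of_nonneg_left h (mul_nonneg hi0 hc0)
    _ ≤ ((i : ℝ) + 1) * 1 * (Real.exp (7 / 2) * (2 : ℝ) ^ (-(i : ℤ))) := by
        gcongr
    _ = _ := by ring
end

section
/- For all integers n ≥ 4 and i with 1 ≤ i ≤ n, one has C(n+3, i) / C(2n, i) ≤ e^3 · 2^{-i}, where C(a,b) denotes the binomial coefficient. -/
/-- One step of the ratio comparison. -/
lemma choose_ratio_step (n i : ℕ) (hi : i < n) (c r : ℝ) (hc : 0 ≤ c)
    (h : ((n + 3).choose i : ℝ) * 2 ^ i ≤ c * ((2 * n).choose i : ℝ))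
    (hr : 2 * ((n : ℝ) + 3 - i) ≤ r * (2 * n - i)) :
    ((n + 3).choose (i + 1) : ℝ) * 2 ^ (i + 1) ≤ (c * r) * ((2 * n).choose (i + 1) : ℝ) := by
  have h1 : ((n + 3).choose (i + 1) : ℝ) * (i + 1) = (n + 3).choose i * ((n : ℝ) + 3 - i) := by
    have := Nat.choose_succ_right_eq (n + 3) i
    have h' := congrArg (Nat.cast : ℕ → ℝ) this
    push_cast [Nat.cast_sub (show i ≤ n + 3 by omega)] at h'
    exact h'
  have h2 : ((2 * n).choose (i + 1) : ℝ) * (i + 1) = (2 * n).choose i * (2 * (n : ℝ) - i) := by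
    have := Nat.choose_succ_right_eq (2 * n) i
    have h' := congrArg (Nat.cast : ℕ → ℝ) this
    push_cast [Nat.cast_sub (show i ≤ 2 * n by omega)] at h'
    exact h'
  have hin : (i : ℝ) < n := by exact_mod_cast hi
  have hpos : (0 : ℝ) < (i : ℝ) + 1 := by positivity
  refine le_of_mul_le_mul_right ?_ hpos
  calc ((n + 3).choose (i + 1) : ℝ) * 2 ^ (i + 1) * (i + 1)
      = ((n + 3).choose i * 2 ^ i) * (2 * ((n : ℝ) + 3 - i)) := by
        rw [pow_succ]; linear_combination (2 ^ i * 2) * h1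
    _ ≤ (c * ((2 * n).choose i : ℝ)) * (r * (2 * n - i)) := by
        apply mul_le_mul h hr (by linarith) (by positivity)
    _ = (c * r) * ((2 * n).choose (i + 1) : ℝ) * (i + 1) := by
        linear_combination (-(c * r)) * h2

/-- The sequence of constants. -/
lemma choose_ratio_aux (n : ℕ) (hn : 4 ≤ n) (i : ℕ) (hi : i ≤ n) :
    ((n + 3).choose i : ℝ) * 2 ^ i ≤
      (if i = 0 then 1 else if i = 1 then 7 / 4 else if i = 2 then 3 else if i = 3 then 5
        else if i = 4 then 8 else if i = 5 then 12 else 16) * ((2 * n).choose i : ℝ) := by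
  have hn' : (4 : ℝ) ≤ n := by exact_mod_cast hn
  induction i with
  | zero => simp
  | succ i ih =>
    have ih := ih (by omega)
    have hlt : i < n := by omega
    have hltR : (i : ℝ) < n := by exact_mod_cast hlt
    by_cases h6 : 6 ≤ i
    · have h6R : (6 : ℝ) ≤ i := by exact_mod_cast h6
      have e : ∀ k, 6 ≤ k → (if k = 0 then (1 : ℝ) else if k = 1 then 7 / 4 else if k = 2 then 3
        else if k = 3 then 5 else if k = 4 then 8 else if k = 5 then 12 else 16) = 16 := by
        intro k hk
        simp [show k ≠ 0 by omega, show k ≠ 1 by omega, show k ≠ 2 by omega,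
          show k ≠ 3 by omega, show k ≠ 4 by omega, show k ≠ 5 by omega]
      rw [e i h6] at ih
      rw [e (i + 1) (by omega)]
      have := choose_ratio_step n i hlt 16 1 (by norm_num) ih (by linarith)
      simpa using this
    · have key := fun c hc h => choose_ratio_step n i hlt c ((14 - 2 * i) / (8 - i)) hc h (by
        have : i < 6 := by omega
        interval_cases i <;> norm_num <;> linarith)
      have key2 := key _ (by split_ifs <;> norm_num) ih
      refine key2.trans (le_of_eq ?_)
      congr 1
      have : i < 6 := by omega
      clear key key2 ih
      interval_cases i <;> norm_num

/-- For all integers `n ≥ 4` and `1 ≤ i ≤ n`, one has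
`C(n+3, i) / C(2n, i) ≤ e^3 · 2^{-i}`.  (This ratio is the probability
`q_{n+3,n-3}(i,0)` that the drawing-without-replacement chain started at
`(n+3, n-3)` ever visits the state `(i,0)`.) -/
theorem choose_ratio_geometric_bound
    (n i : ℕ) (hn : 4 ≤ n) (hi1 : 1 ≤ i) (hi2 : i ≤ n) :
    ((n + 3).choose i : ℝ) / ((2 * n).choose i : ℝ)
      ≤ Real.exp 3 * (2 : ℝ) ^ (-(i : ℤ)) := by
  have hB : (0 : ℝ) < ((2 * n).choose i : ℝ) := by
    exact_mod_cast Nat.choose_pos (by omega)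
  have he : (16 : ℝ) ≤ Real.exp 3 := by
    have h1 : Real.exp 3 = Real.exp 1 ^ 3 := by
      rw [← Real.exp_nat_mul]; norm_num
    have h2 : (2.7 : ℝ) ≤ Real.exp 1 := by linarith [Real.exp_one_gt_d9]
    rw [h1]
    calc (16 : ℝ) ≤ 2.7 ^ 3 := by norm_num
      _ ≤ _ := by gcongr
  have h := choose_ratio_aux n hn i hi2
  have h16 : ((n + 3).choose i : ℝ) * 2 ^ i ≤ Real.exp 3 * ((2 * n).choose i : ℝ) := by
    refine h.trans (mul_le_mul_of_nonneg_right (le_trans ?_ he) hB.le)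
    split_ifs <;> norm_num
  rw [zpow_neg, zpow_natCast, ← div_eq_mul_inv, div_le_div_iff₀ hB (by positivity)]
  exact h16
end

section
/- For every real δ > 0, the double series Σ_{n=4}^{∞} 2^{-δn} · Σ_{i=1}^{n-3} 2^{i} · [ ((n-3)/(2n)) · ∏_{k=0}^{i-1} (n+3-k)/(2n-1-k) + (1/i) · C(n+3, i)/C(2n, i) ] converges (has a finite sum). -/
/-- The weight bounding the `k`-th factor. -/
lemma peierls_prod_bound (m i : ℕ) (hi : i ≤ m + 1) :
    0 ≤ ∏ k ∈ Finset.range i, (((m + 4 : ℕ) : ℝ) + 3 - (k : ℝ))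
          / (2 * ((m + 4 : ℕ) : ℝ) - 1 - (k : ℝ)) ∧
    (2 : ℝ) ^ i * ∏ k ∈ Finset.range i, (((m + 4 : ℕ) : ℝ) + 3 - (k : ℝ))
          / (2 * ((m + 4 : ℕ) : ℝ) - 1 - (k : ℝ)) ≤ 2 ^ (min i 7) := by
  induction i with
  | zero => simp
  | succ j ih =>
    obtain ⟨h0, h1⟩ := ih (by omega)
    have hj : (j : ℝ) ≤ m := by exact_mod_cast (by omega : j ≤ m)
    have hj0 : (0 : ℝ) ≤ j := Nat.cast_nonneg j
    have hd : (0 : ℝ) < 2 * ((m + 4 : ℕ) : ℝ) - 1 - (j : ℝ) := by push_cast; linarith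
    have hn : (0 : ℝ) ≤ ((m + 4 : ℕ) : ℝ) + 3 - (j : ℝ) := by push_cast; linarith
    have hf := div_nonneg hn hd.le
    rw [Finset.prod_range_succ]
    refine ⟨mul_nonneg h0 hf, ?_⟩
    set P := ∏ k ∈ Finset.range j, (((m + 4 : ℕ) : ℝ) + 3 - (k : ℝ))
          / (2 * ((m + 4 : ℕ) : ℝ) - 1 - (k : ℝ)) with hP
    set f := (((m + 4 : ℕ) : ℝ) + 3 - (j : ℝ)) / (2 * ((m + 4 : ℕ) : ℝ) - 1 - (j : ℝ)) with hfd
    have e : (2 : ℝ) ^ (j + 1) * (P * f) = (2 ^ j * P) * (2 * f) := by ring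
    rw [e]
    rcases lt_or_ge j 7 with h7 | h7
    · have hf2 : 2 * f ≤ 2 := by
        have : f ≤ 1 := by
          rw [hfd, div_le_one hd]; push_cast; linarith
        linarith
      rw [min_eq_left (by omega : j + 1 ≤ 7), pow_succ]
      rw [min_eq_left (by omega : j ≤ 7)] at h1
      exact mul_le_mul h1 hf2 (by positivity) (by positivity)
    · have h7' : (7 : ℝ) ≤ j := by exact_mod_cast h7
      have hf2 : 2 * f ≤ 1 := by
        have : f ≤ 1 / 2 := by
          rw [hfd, div_le_iff₀ hd]; push_cast; linarith
        linarith
      rw [min_eq_right (by omega : 7 ≤ j + 1)]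
      rw [min_eq_right (by omega : 7 ≤ j)] at h1
      calc _ ≤ (2 : ℝ) ^ 7 * 1 := mul_le_mul h1 hf2 (by positivity) (by positivity)
        _ = _ := by ring

/-- The ratio of binomial coefficients is at most the product. -/
lemma peierls_choose_bound (m i : ℕ) (hi : i ≤ m + 1) :
    (((m + 4) + 3).choose i : ℝ) / ((2 * (m + 4)).choose i : ℝ) ≤
      ∏ k ∈ Finset.range i, (((m + 4 : ℕ) : ℝ) + 3 - (k : ℝ))
          / (2 * ((m + 4 : ℕ) : ℝ) - 1 - (k : ℝ)) := by
  induction i with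
  | zero => simp
  | succ j ih =>
    have h0 := (peierls_prod_bound m j (by omega)).1
    have ih := ih (by omega)
    have hj : (j : ℝ) ≤ m := by exact_mod_cast (by omega : j ≤ m)
    have hj0 : (0 : ℝ) ≤ j := Nat.cast_nonneg j
    have hd : (0 : ℝ) < 2 * ((m + 4 : ℕ) : ℝ) - 1 - (j : ℝ) := by push_cast; linarith
    have hd' : (0 : ℝ) < 2 * ((m + 4 : ℕ) : ℝ) - (j : ℝ) := by linarith
    have hn : (0 : ℝ) ≤ ((m + 4 : ℕ) : ℝ) + 3 - (j : ℝ) := by push_cast; linarith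
    rw [Finset.prod_range_succ]
    have hA : (((m + 4) + 3).choose (j + 1) : ℝ) * (j + 1)
        = ((m + 4) + 3).choose j * (((m + 4 : ℕ) : ℝ) + 3 - (j : ℝ)) := by
      have := congrArg (Nat.cast (R := ℝ)) (Nat.choose_succ_right_eq ((m + 4) + 3) j)
      rw [Nat.cast_mul, Nat.cast_mul, Nat.cast_sub (by omega)] at this
      push_cast at this ⊢
      exact this
    have hB : ((2 * (m + 4)).choose (j + 1) : ℝ) * (j + 1)
        = (2 * (m + 4)).choose j * (2 * ((m + 4 : ℕ) : ℝ) - (j : ℝ)) := by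
      have := congrArg (Nat.cast (R := ℝ)) (Nat.choose_succ_right_eq (2 * (m + 4)) j)
      rw [Nat.cast_mul, Nat.cast_mul, Nat.cast_sub (by omega)] at this
      push_cast at this ⊢
      exact this
    have hj1 : (j : ℝ) + 1 ≠ 0 := by positivity
    calc (((m + 4) + 3).choose (j + 1) : ℝ) / ((2 * (m + 4)).choose (j + 1) : ℝ)
        = ((((m + 4) + 3).choose (j + 1) : ℝ) * (j + 1))
            / (((2 * (m + 4)).choose (j + 1) : ℝ) * (j + 1)) := by
          rw [mul_div_mul_right _ _ hj1]
      _ = (((m + 4) + 3).choose j : ℝ) / ((2 * (m + 4)).choose j : ℝ)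
            * ((((m + 4 : ℕ) : ℝ) + 3 - (j : ℝ)) / (2 * ((m + 4 : ℕ) : ℝ) - (j : ℝ))) := by
          rw [hA, hB, mul_div_mul_comm]
      _ ≤ _ := by
          apply mul_le_mul ih _ (div_nonneg hn hd'.le) h0
          exact div_le_div_of_nonneg_left hn hd (by linarith)

/-- For every real `δ > 0`, the double series
`Σ_{n=4}^∞ 2^{-δn} Σ_{i=1}^{n-3} 2^i [ ((n-3)/(2n)) · ∏_{k=0}^{i-1} (n+3-k)/(2n-1-k)
  + (1/i) · C(n+3,i)/C(2n,i) ]`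
converges.  (Statement (9), "to-show-2", of the paper's Peierls argument for
hegemony of the constant-rate empire process.) -/
theorem peierls_series_summable (δ : ℝ) (hδ : 0 < δ) :
    Summable (fun m : ℕ =>
      (2 : ℝ) ^ (-(δ * ((m + 4 : ℕ) : ℝ))) *
        ∑ i ∈ Finset.Icc 1 ((m + 4) - 3),
          (2 : ℝ) ^ (i : ℕ) *
            ((((m + 4 : ℕ) : ℝ) - 3) / (2 * ((m + 4 : ℕ) : ℝ))
                * ∏ k ∈ Finset.range i,
                    (((m + 4 : ℕ) : ℝ) + 3 - (k : ℝ))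
                      / (2 * ((m + 4 : ℕ) : ℝ) - 1 - (k : ℝ))
              + (1 / (i : ℝ)) *
                  (((m + 4) + 3).choose i : ℝ) / ((2 * (m + 4)).choose i : ℝ))) := by
  have hr0 : (0 : ℝ) < (2 : ℝ) ^ (-δ) := by positivity
  have hr1 : (2 : ℝ) ^ (-δ) < 1 :=
    Real.rpow_lt_one_of_one_lt_of_neg (by norm_num) (by linarith)
  have hs : Summable (fun n : ℕ => (n : ℝ) ^ 1 * ((2 : ℝ) ^ (-δ)) ^ n) :=
    summable_pow_mul_geometric_of_norm_lt_one 1 (by rwa [Real.norm_of_nonneg hr0.le])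
  have hs4 := ((summable_nat_add_iff 4).mpr hs).mul_left 256
  have hterm : ∀ m : ℕ, ∀ i ∈ Finset.Icc 1 ((m + 4) - 3),
      0 ≤ (2 : ℝ) ^ (i : ℕ) *
            ((((m + 4 : ℕ) : ℝ) - 3) / (2 * ((m + 4 : ℕ) : ℝ))
                * ∏ k ∈ Finset.range i,
                    (((m + 4 : ℕ) : ℝ) + 3 - (k : ℝ))
                      / (2 * ((m + 4 : ℕ) : ℝ) - 1 - (k : ℝ))
              + (1 / (i : ℝ)) *
                  (((m + 4) + 3).choose i : ℝ) / ((2 * (m + 4)).choose i : ℝ)) ∧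
      (2 : ℝ) ^ (i : ℕ) *
            ((((m + 4 : ℕ) : ℝ) - 3) / (2 * ((m + 4 : ℕ) : ℝ))
                * ∏ k ∈ Finset.range i,
                    (((m + 4 : ℕ) : ℝ) + 3 - (k : ℝ))
                      / (2 * ((m + 4 : ℕ) : ℝ) - 1 - (k : ℝ))
              + (1 / (i : ℝ)) *
                  (((m + 4) + 3).choose i : ℝ) / ((2 * (m + 4)).choose i : ℝ)) ≤ 256 := by
    intro m i hi
    rw [Finset.mem_Icc] at hi
    obtain ⟨h0, h1⟩ := peierls_prod_bound m i (by omega)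
    have h2 := peierls_choose_bound m i (by omega)
    have hm : (0 : ℝ) ≤ m := Nat.cast_nonneg m
    have hi1 : (1 : ℝ) ≤ i := by exact_mod_cast hi.1
    have h3 : (2 : ℝ) ^ (min i 7) ≤ 2 ^ 7 :=
      pow_le_pow_right₀ (by norm_num) (min_le_right _ _)
    have hc0 : 0 ≤ (((m + 4 : ℕ) : ℝ) - 3) / (2 * ((m + 4 : ℕ) : ℝ)) := by
      apply div_nonneg <;> push_cast <;> linarith
    have hc1 : (((m + 4 : ℕ) : ℝ) - 3) / (2 * ((m + 4 : ℕ) : ℝ)) ≤ 1 := by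
      rw [div_le_one (by positivity)]; push_cast; linarith
    have hq0 : 0 ≤ (((m + 4) + 3).choose i : ℝ) / ((2 * (m + 4)).choose i : ℝ) := by positivity
    have hi0 : (0 : ℝ) ≤ 1 / (i : ℝ) := by positivity
    have hi2 : 1 / (i : ℝ) ≤ 1 := by rw [div_le_one (by linarith)]; exact hi1
    rw [mul_div_assoc]
    generalize (∏ k ∈ Finset.range i, (((m + 4 : ℕ) : ℝ) + 3 - (k : ℝ))
          / (2 * ((m + 4 : ℕ) : ℝ) - 1 - (k : ℝ))) = P at *
    generalize (((m + 4) + 3).choose i : ℝ) / ((2 * (m + 4)).choose i : ℝ) = Q at *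
    generalize (((m + 4 : ℕ) : ℝ) - 3) / (2 * ((m + 4 : ℕ) : ℝ)) = c at *
    generalize 1 / (i : ℝ) = d at *
    refine ⟨by positivity, ?_⟩
    have a1 : c * P ≤ P := mul_le_of_le_one_left h0 hc1
    have a2 : d * Q ≤ P := (mul_le_of_le_one_left hq0 hi2).trans h2
    calc (2 : ℝ) ^ i * (c * P + d * Q) ≤ 2 ^ i * (P + P) := by gcongr
      _ = 2 * (2 ^ i * P) := by ring
      _ ≤ 2 * 2 ^ 7 := by linarith
      _ = 256 := by norm_num
  refine Summable.of_nonneg_of_le (fun m => ?_) (fun m => ?_) hs4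
  · exact mul_nonneg (by positivity) (Finset.sum_nonneg fun i hi => (hterm m i hi).1)
  · have hsum := Finset.sum_le_card_nsmul _ _ _ (fun i hi => (hterm m i hi).2)
    rw [Nat.card_Icc, nsmul_eq_mul] at hsum
    have hcard : (((m + 4) - 3 + 1 - 1 : ℕ) : ℝ) ≤ ((m + 4 : ℕ) : ℝ) := by
      exact_mod_cast (by omega : (m + 4) - 3 + 1 - 1 ≤ m + 4)
    have he : (2 : ℝ) ^ (-(δ * ((m + 4 : ℕ) : ℝ))) = ((2 : ℝ) ^ (-δ)) ^ (m + 4) := by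
      rw [← Real.rpow_natCast, ← Real.rpow_mul (by norm_num), neg_mul]
    rw [he]
    calc _ ≤ ((2 : ℝ) ^ (-δ)) ^ (m + 4) * (((m + 4 : ℕ) : ℝ) * 256) := by
          apply mul_le_mul_of_nonneg_left _ (by positivity)
          exact hsum.trans (by linarith)
      _ = _ := by ring
end
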